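/- Let (A, ·) be one of the following 3-dimensional commutative associative ℂ-algebras with basis e₁, e₂, e₃ (only nonzero products listed): 𝔄₀₁: e₁·e₁ = e₁, e₂·e₂ = e₂, e₃·e₃ = e₃; 𝔄₀₃: e₁·e₁ = e₁, e₂·e₂ = e₂; 𝔄₀₇: e₁·e₁ = e₁, e₂·e₂ = e₃; 𝔄₀₈: e₁·e₁ = e₁; 𝔄₁₁: e₁·e₁ = e₂. Then for every derivation D of (A, ·), one has D(x)·y − x·D(y) = 0 for all x, y ∈ A. -/

import Mathlib

noncomputable section

abbrev V3 : Type := Fin 3 → ℂ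

def e (i : Fin 3) : V3 := Pi.single i 1

def mA01 : V3 → V3 → V3 := fun x y => ![(x 0 * y 0), (x 1 * y 1), (x 2 * y 2)]

def mA03 : V3 → V3 → V3 := fun x y => ![(x 0 * y 0), (x 1 * y 1), (0 : ℂ)]

def mA07 : V3 → V3 → V3 := fun x y => ![(x 0 * y 0), (0 : ℂ), (x 1 * y 1)]

def mA08 : V3 → V3 → V3 := fun x y => ![(x 0 * y 0), (0 : ℂ), (0 : ℂ)]

def mA11 : V3 → V3 → V3 := fun x y => ![(0 : ℂ), (x 0 * y 0), (0 : ℂ)]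

theorem derivation_apply_basis_eq_zero {m : V3 → V3 → V3} {D : V3 →ₗ[ℂ] V3}
    (hD : ∀ x y, D (m x y) = m (D x) y + m x (D y)) {i j k : Fin 3}
    (hk : ∀ x y, m x y k = x i * y i) (hij : j ≠ i) (h0 : m (e i) (e j) = 0) :
    D (e j) i = 0 := by
  have h : D (m (e i) (e j)) k = m (D (e i)) (e j) k + m (e i) (D (e j)) k :=
    congrFun (hD (e i) (e j)) k
  rw [h0, map_zero, hk, hk] at h
  simpa [e, hij.symm] using h.symm

theorem derivation_apply_coord {m : V3 → V3 → V3} {D : V3 →ₗ[ℂ] V3}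
    (hD : ∀ x y, D (m x y) = m (D x) y + m x (D y)) {i k : Fin 3}
    (hk : ∀ x y, m x y k = x i * y i) (h0 : ∀ j, j ≠ i → m (e i) (e j) = 0) (x : V3) :
    D x i = x i * D (e i) i := by
  have hx : x = ∑ j, x j • e j := by
    simpa [e] using (pi_eq_sum_univ' x)
  conv_lhs => rw [hx, map_sum, Finset.sum_apply]
  rw [Finset.sum_eq_single i]
  · simp
  · intro j _ hj
    simp [derivation_apply_basis_eq_zero hD hk hj (h0 j hj)]
  · simp

/-- If `m x y k = x i * y i` and `e i` annihilates the other basis vectors, then every derivation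
acts on the `i`-th coordinate by a scalar, so `D x * y` and `x * D y` agree at `k`. -/
theorem derivation_balanced_coord {m : V3 → V3 → V3} {D : V3 →ₗ[ℂ] V3}
    (hD : ∀ x y, D (m x y) = m (D x) y + m x (D y)) {i k : Fin 3}
    (hk : ∀ x y, m x y k = x i * y i) (h0 : ∀ j, j ≠ i → m (e i) (e j) = 0) (x y : V3) :
    m (D x) y k = m x (D y) k := by
  rw [hk, hk, derivation_apply_coord hD hk h0 x, derivation_apply_coord hD hk h0 y]
  ring

theorem statement18 (m : V3 → V3 → V3)
    (hmem : m = mA01 ∨ m = mA03 ∨ m = mA07 ∨ m = mA08 ∨ m = mA11)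
    (D : V3 →ₗ[ℂ] V3)
    (hD : ∀ x y, D (m x y) = m (D x) y + m x (D y)) :
    ∀ x y, m (D x) y - m x (D y) = 0 := by
  intro x y
  rw [sub_eq_zero]
  ext k
  rcases hmem with rfl | rfl | rfl | rfl | rfl
  · exact derivation_balanced_coord hD (i := k) (by intro x y; fin_cases k <;> rfl)
      (by intro j hj; ext l; fin_cases k <;> fin_cases j <;> fin_cases l <;> simp_all [mA01, e]) x y
  · fin_cases k
    · exact derivation_balanced_coord hD (i := 0) (fun _ _ => rfl)
        (by intro j hj; ext l; fin_cases j <;> fin_cases l <;> simp_all [mA03, e]) x y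
    · exact derivation_balanced_coord hD (i := 1) (fun _ _ => rfl)
        (by intro j hj; ext l; fin_cases j <;> fin_cases l <;> simp_all [mA03, e]) x y
    · rfl
  · fin_cases k
    · exact derivation_balanced_coord hD (i := 0) (fun _ _ => rfl)
        (by intro j hj; ext l; fin_cases j <;> fin_cases l <;> simp_all [mA07, e]) x y
    · rfl
    · exact derivation_balanced_coord hD (i := 1) (fun _ _ => rfl)
        (by intro j hj; ext l; fin_cases j <;> fin_cases l <;> simp_all [mA07, e]) x y
  · fin_cases k
    · exact derivation_balanced_coord hD (i := 0) (fun _ _ => rfl)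
        (by intro j hj; ext l; fin_cases j <;> fin_cases l <;> simp_all [mA08, e]) x y
    · rfl
    · rfl
  · fin_cases k
    · rfl
    · exact derivation_balanced_coord hD (i := 0) (fun _ _ => rfl)
        (by intro j hj; ext l; fin_cases j <;> fin_cases l <;> simp_all [mA11, e]) x y
    · rfl
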